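/- arXiv:1308.6711 — 3 statements merged into one kernel-verified Lean document; each statement's English description precedes it below -/
import Mathlib

section
/- Let W ⊆ ℝ² be a closed wedge with apex p ∈ ℤ², i.e., the intersection of two closed half-planes whose boundary lines meet exactly in the point p, and suppose W is contained in the closed upper half-plane {q : q₂ ≥ p₂}. Suppose the intersection of W with the horizontal line {q : q₂ = p₂ + 1} is a segment of length s with 0 < s. If for some real d > 0 the horizontal line {q : q₂ = p₂ + d} contains two distinct points of W ∩ ℤ², then d ≥ 1/s. -/
/-- The real point corresponding to a lattice point of `ℤ²`. -/
def toPlane (q : ℤ × ℤ) : ℝ × ℝ := ((q.1 : ℝ), (q.2 : ℝ))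

/-- Euclidean dot product on `ℝ²`. -/
def dot2 (u v : ℝ × ℝ) : ℝ := u.1 * v.1 + u.2 * v.2

/-- Determinant of two vectors of `ℝ²`. -/
def det2 (u v : ℝ × ℝ) : ℝ := u.1 * v.2 - u.2 * v.1

/-!
STATEMENT 4.  A closed wedge `W` with apex at a lattice point `p` is the intersection
of two closed half-planes `{q | u_i ⬝ (q - p) ≤ 0}` whose boundary lines pass through
`p` and meet exactly in `p` (i.e. the normals `u₁, u₂` are linearly independent,
`det2 u₁ u₂ ≠ 0`).  If `W` lies in the closed upper half-plane of `p`, its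
intersection with the horizontal line at height `p₂ + 1` is a segment of length
`s > 0`, and some horizontal line at height `p₂ + d` (`d > 0`) contains two distinct
lattice points of `W`, then `d ≥ 1/s`.
-/
theorem wedge_lattice_points_height_bound
    (p : ℤ × ℤ) (u₁ u₂ : ℝ × ℝ) (hdet : det2 u₁ u₂ ≠ 0)
    (W : Set (ℝ × ℝ))
    (hW : W = {q : ℝ × ℝ | dot2 u₁ (q - toPlane p) ≤ 0 ∧ dot2 u₂ (q - toPlane p) ≤ 0})
    (hupper : W ⊆ {q : ℝ × ℝ | (p.2 : ℝ) ≤ q.2})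
    (x₁ x₂ s : ℝ) (hs : s = x₂ - x₁) (hspos : 0 < s)
    (hseg : {q ∈ W | q.2 = (p.2 : ℝ) + 1} =
      segment ℝ (x₁, (p.2 : ℝ) + 1) (x₂, (p.2 : ℝ) + 1))
    (d : ℝ) (hd : 0 < d)
    (q₁ q₂ : ℤ × ℤ) (hne : q₁ ≠ q₂)
    (h₁ : toPlane q₁ ∈ W) (h₂ : toPlane q₂ ∈ W)
    (hy₁ : (q₁.2 : ℝ) = (p.2 : ℝ) + d) (hy₂ : (q₂.2 : ℝ) = (p.2 : ℝ) + d) :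
    1 / s ≤ d := by
  have key : ∀ q : ℤ × ℤ, toPlane q ∈ W → (q.2 : ℝ) = (p.2 : ℝ) + d →
      x₁ ≤ (p.1 : ℝ) + ((q.1 : ℝ) - p.1) / d ∧ (p.1 : ℝ) + ((q.1 : ℝ) - p.1) / d ≤ x₂ := by
    intro q hq hy
    have hmem : (((p.1 : ℝ) + ((q.1 : ℝ) - p.1) / d, (p.2 : ℝ) + 1) : ℝ × ℝ) ∈
        {q ∈ W | q.2 = (p.2 : ℝ) + 1} := by
      refine ⟨?_, rfl⟩
      rw [hW] at hq ⊢
      simp only [Set.mem_ofPred_eq, dot2, toPlane, Prod.fst_sub, Prod.snd_sub, hy,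
        add_sub_cancel_left] at hq ⊢
      have scale : ∀ a b : ℝ, a * ((q.1 : ℝ) - p.1) + b * d ≤ 0 →
          a * (((q.1 : ℝ) - p.1) / d) + b * 1 ≤ 0 := by
        intro a b h
        have e : a * (((q.1 : ℝ) - p.1) / d) + b * 1
            = (a * ((q.1 : ℝ) - p.1) + b * d) / d := by
          field_simp
        rw [e]
        exact div_nonpos_of_nonpos_of_nonneg h hd.le
      exact ⟨scale _ _ hq.1, scale _ _ hq.2⟩
    rw [hseg] at hmem
    obtain ⟨a, b, ha, hb, hab, h⟩ := hmem
    have h1 := congrArg Prod.fst h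
    simp only [Prod.fst_add, Prod.smul_fst, smul_eq_mul] at h1
    rw [← h1]
    have ea : a = 1 - b := by linarith
    subst ea
    constructor <;> nlinarith
  have k₁ := key q₁ h₁ hy₁
  have k₂ := key q₂ h₂ hy₂
  have hy : q₁.2 = q₂.2 := by
    have : (q₁.2 : ℝ) = q₂.2 := by rw [hy₁, hy₂]
    exact_mod_cast this
  have hx : q₁.1 ≠ q₂.1 := fun h => hne (Prod.ext h hy)
  have habs : (1 : ℝ) ≤ |(q₁.1 : ℝ) - q₂.1| := by
    have := Int.one_le_abs (sub_ne_zero.mpr hx)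
    exact_mod_cast this
  have hle : |(q₁.1 : ℝ) - q₂.1| / d ≤ s := by
    rw [← abs_of_pos hd, ← abs_div, abs_le]
    have e : ((q₁.1 : ℝ) - q₂.1) / d
        = ((q₁.1 : ℝ) - p.1) / d - ((q₂.1 : ℝ) - p.1) / d := by ring
    rw [e]
    constructor <;> linarith [k₁.1, k₁.2, k₂.1, k₂.2]
  rw [div_le_iff₀ hd] at hle
  rw [div_le_iff₀ hspos]
  linarith
end

section
/- Let K ⊆ ℝ² be a convex set with nonempty interior, let p₁,…,p_k (k ≥ 2) be distinct points of the frontier of K that lie in strictly convex position, listed in counterclockwise order, and let v be a point of the interior of K. Then: (a) for each i, the closed segment [v, p_i] is contained in the closure of K and meets the frontier of K only in the point p_i; (b) for i ≠ j, the segments [v, p_i] and [v, p_j] intersect exactly in {v}; and (c) the counterclockwise cyclic order of the directions p_i − v around v coincides with the cyclic order of the indices 1,…,k — in particular this angular order is the same for every choice of the interior point v. -/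
/-- The argument (polar angle) of a nonzero vector of `ℝ²`, in `(-π, π]`. -/
noncomputable def argOf (w : ℝ × ℝ) : ℝ := Complex.arg ⟨w.1, w.2⟩

/-- The angle of `w`, measured counterclockwise from `b`, normalized to `[0, 2π)`
(for vectors with distinct directions; it is `0` when the directions agree). -/
noncomputable def ccwAngleFrom (b w : ℝ × ℝ) : ℝ :=
  if argOf w - argOf b < 0 then argOf w - argOf b + 2 * Real.pi
  else argOf w - argOf b

/-- The nonzero vectors `w 0, …, w (k-1)` are in counterclockwise cyclic order
coinciding with the cyclic order of the indices: some cyclic rotation of the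
indices makes the angles, measured counterclockwise from the first vector,
strictly increasing in `[0, 2π)`. -/
def CyclicCCW (k : ℕ) (w : Fin k → ℝ × ℝ) : Prop :=
  k = 0 ∨ ∃ r : Fin k, StrictMono fun i : Fin k => ccwAngleFrom (w r) (w (r + i))

theorem aux_support (K : Set (ℝ × ℝ)) (hK : Convex ℝ K) (v : ℝ × ℝ) (hv : v ∈ interior K)
    (p : ℝ × ℝ) (hp : p ∈ frontier K) :
    ∃ f : ℝ × ℝ →ₗ[ℝ] ℝ, 0 < f (p - v) ∧ ∀ q ∈ frontier K, f (q - v) ≤ f (p - v) := by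
  obtain ⟨f, hf⟩ := geometric_hahn_banach_open_point hK.interior isOpen_interior hp.2
  refine ⟨f.toLinearMap, ?_, ?_⟩
  · have := hf v hv
    simp only [map_sub]
    exact sub_pos.mpr this
  · intro q hq
    have h1 : q ∈ closure (interior K) := by
      rw [hK.closure_interior_eq_closure_of_nonempty_interior ⟨v, hv⟩]
      exact hq.1
    have h2 : closure (interior K) ⊆ {x | f x ≤ f p} :=
      closure_minimal (fun x hx => (hf x hx).le) (isClosed_le f.continuous continuous_const)
    have h3 : f q ≤ f p := h2 h1
    simp only [map_sub]
    exact sub_le_sub_right h3 _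

theorem aux_lin (f : ℝ × ℝ →ₗ[ℝ] ℝ) (a b c : ℝ × ℝ) :
    det2 b c * f a + det2 c a * f b + det2 a b * f c = 0 := by
  have h : det2 b c • a + det2 c a • b + det2 a b • c = 0 := by
    ext <;> simp [det2] <;> ring
  have := congrArg f h
  simpa using this

theorem aux_two (f : ℝ × ℝ →ₗ[ℝ] ℝ) (a b c : ℝ × ℝ) (ha : 0 < f a) (hb : f b ≤ f a)
    (hc : f c ≤ f a) (h : 0 < det2 a b + det2 b c + det2 c a) :
    0 < det2 c a ∨ 0 < det2 a b := by
  by_contra! hh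
  have h0 := aux_lin f a b c
  nlinarith [mul_pos h ha, mul_nonneg (neg_nonneg.2 hh.1) (sub_nonneg.2 hb),
    mul_nonneg (neg_nonneg.2 hh.2) (sub_nonneg.2 hc)]

theorem aux_polar (a : ℝ × ℝ) : ∃ r : ℝ, 0 ≤ r ∧ a.1 = r * Real.cos (argOf a) ∧
    a.2 = r * Real.sin (argOf a) := by
  refine ⟨‖(⟨a.1, a.2⟩ : ℂ)‖, norm_nonneg _, ?_, ?_⟩
  · exact (Complex.norm_mul_cos_arg ⟨a.1, a.2⟩).symm
  · exact (Complex.norm_mul_sin_arg ⟨a.1, a.2⟩).symm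

theorem aux_det (a b : ℝ × ℝ) : ∃ r : ℝ, 0 ≤ r ∧
    det2 a b = r * Real.sin (argOf b - argOf a) := by
  obtain ⟨r, hr, h1, h2⟩ := aux_polar a
  obtain ⟨s, hs, h3, h4⟩ := aux_polar b
  refine ⟨r * s, mul_nonneg hr hs, ?_⟩
  rw [Real.sin_sub]
  unfold det2
  rw [h1, h2, h3, h4]
  ring

theorem aux_range (a b : ℝ × ℝ) : 0 ≤ ccwAngleFrom a b ∧ ccwAngleFrom a b < 2 * Real.pi := by
  have h1 := Complex.neg_pi_lt_arg ⟨a.1, a.2⟩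
  have h2 := Complex.arg_le_pi ⟨a.1, a.2⟩
  have h3 := Complex.neg_pi_lt_arg ⟨b.1, b.2⟩
  have h4 := Complex.arg_le_pi ⟨b.1, b.2⟩
  unfold ccwAngleFrom argOf
  split_ifs <;> constructor <;> linarith

theorem aux_angle (a b : ℝ × ℝ) : ∃ n : ℤ, argOf b = argOf a + ccwAngleFrom a b
    - n * (2 * Real.pi) := by
  unfold ccwAngleFrom
  split_ifs
  · exact ⟨1, by push_cast; ring⟩
  · exact ⟨0, by push_cast; ring⟩

theorem aux_sinpos (r x : ℝ) (hr : 0 ≤ r) (h : 0 < r * Real.sin x) : 0 < Real.sin x :=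
  pos_of_mul_pos_right h hr

theorem aux_lt (a b c : ℝ × ℝ) (h1 : 0 < det2 c a ∨ 0 < det2 a b)
    (h2 : 0 < det2 a b ∨ 0 < det2 b c) (h3 : 0 < det2 b c ∨ 0 < det2 c a) :
    ccwAngleFrom a b < ccwAngleFrom a c := by
  obtain ⟨hb0, hb1⟩ := aux_range a b
  obtain ⟨hc0, hc1⟩ := aux_range a c
  obtain ⟨n, hn⟩ := aux_angle a b
  obtain ⟨m, hm⟩ := aux_angle a c
  set β := ccwAngleFrom a b
  set γ := ccwAngleFrom a c
  have x1 : 0 < det2 a b → 0 < Real.sin β := by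
    obtain ⟨r, hr, h⟩ := aux_det a b
    intro h'
    rw [h] at h'
    have := aux_sinpos _ _ hr h'
    rwa [show argOf b - argOf a = β - n * (2 * Real.pi) by rw [hn]; ring,
      Real.sin_sub_int_mul_two_pi] at this
  have x2 : 0 < det2 b c → 0 < Real.sin (γ - β) := by
    obtain ⟨r, hr, h⟩ := aux_det b c
    intro h'
    rw [h] at h'
    have := aux_sinpos _ _ hr h'
    rwa [show argOf c - argOf b = γ - β - (m - n : ℤ) * (2 * Real.pi) by
      rw [hn, hm]; push_cast; ring, Real.sin_sub_int_mul_two_pi] at this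
  have x3 : 0 < det2 c a → Real.sin γ < 0 := by
    obtain ⟨r, hr, h⟩ := aux_det c a
    intro h'
    rw [h] at h'
    have := aux_sinpos _ _ hr h'
    rw [show argOf a - argOf c = -(γ - m * (2 * Real.pi)) by rw [hm]; ring, Real.sin_neg,
      Real.sin_sub_int_mul_two_pi] at this
    linarith
  by_contra! hle
  have y1 : 0 < Real.sin β → β < Real.pi := by
    intro h
    by_contra! h'
    have := Real.sin_nonneg_of_nonneg_of_le_pi (x := β - Real.pi) (by linarith) (by linarith)
    rw [Real.sin_sub_pi] at this
    linarith
  have y3 : Real.sin γ < 0 → Real.pi < γ := by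
    intro h
    by_contra! h'
    have := Real.sin_nonneg_of_nonneg_of_le_pi hc0 h'
    linarith
  have y2 : 0 < Real.sin (γ - β) → γ - β < -Real.pi := by
    intro h
    by_contra! h'
    have := Real.sin_nonneg_of_nonneg_of_le_pi (x := β - γ) (by linarith) (by linarith)
    rw [← neg_sub, Real.sin_neg] at h
    linarith
  have z1 := fun h => y1 (x1 h)
  have z2 := fun h => y2 (x2 h)
  have z3 := fun h => y3 (x3 h)
  rcases h1 with h1 | h1 <;> rcases h2 with h2 | h2 <;> rcases h3 with h3 | h3 <;>
  first
  | linarith [z1 h1, z2 h2]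
  | linarith [z1 h1, z2 h3]
  | linarith [z1 h1, z3 h3]
  | linarith [z3 h1, z1 h2]
  | linarith [z3 h1, z2 h2]

/-- two vectors with a common positive multiple and supports agree -/
theorem aux_eq (f g : ℝ × ℝ →ₗ[ℝ] ℝ) (a b : ℝ × ℝ) (fa : 0 < f a) (fb : f b ≤ f a)
    (gb : 0 < g b) (ga : g a ≤ g b) (s t : ℝ) (hs : 0 ≤ s) (ht : 0 ≤ t)
    (h : s • a = t • b) : s = t := by
  have h1 := congrArg f h
  have h2 := congrArg g h
  simp only [map_smul, smul_eq_mul] at h1 h2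
  apply le_antisymm
  · by_contra! hh
    nlinarith [mul_le_mul_of_nonneg_left fb ht, mul_pos (sub_pos.2 hh) fa]
  · by_contra! hh
    nlinarith [mul_le_mul_of_nonneg_left ga hs, mul_pos (sub_pos.2 hh) gb]

theorem interior_point_sees_convex_position_points_in_cyclic_order
    (K : Set (ℝ × ℝ)) (hK : Convex ℝ K) (hint : (interior K).Nonempty)
    (k : ℕ) (hk : 2 ≤ k) (P : Fin k → ℝ × ℝ) (hinj : Function.Injective P)
    (hfr : ∀ i, P i ∈ frontier K)
    (hccw : ∀ i j l : Fin k, i < j → j < l → 0 < det2 (P j - P i) (P l - P i))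
    (v : ℝ × ℝ) (hv : v ∈ interior K) :
    (∀ i, segment ℝ v (P i) ⊆ closure K ∧
      segment ℝ v (P i) ∩ frontier K = {P i}) ∧
    (∀ i j, i ≠ j → segment ℝ v (P i) ∩ segment ℝ v (P j) = {v}) ∧
    CyclicCCW k (fun i => P i - v) := by
  have hk0 : 0 < k := by omega
  have hs := fun i => aux_support K hK v hv (P i) (hfr i)
  choose f hf0 hf using hs
  have key : ∀ i j, i ≠ j → ∀ s t : ℝ, 0 ≤ s → 0 ≤ t →
      s • (P i - v) = t • (P j - v) → s = 0 := by
    intro i j hij s t hs ht h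
    have hst := aux_eq (f i) (f j) _ _ (hf0 i) (hf i _ (hfr j)) (hf0 j) (hf j _ (hfr i)) s t hs ht h
    subst hst
    by_contra h0
    have := smul_right_injective _ h0 h
    exact hij (hinj (sub_left_injective this))
  refine ⟨?_, ?_, Or.inr ⟨⟨0, hk0⟩, ?_⟩⟩
  · intro i
    refine ⟨hK.closure.segment_subset (interior_subset_closure hv) (hfr i).1, ?_⟩
    apply Set.Subset.antisymm
    · rintro x ⟨hx, hxf⟩
      by_contra hne
      rw [segment_eq_image_lineMap] at hx
      have hx' : x ∈ segment ℝ v (P i) := by rwa [segment_eq_image_lineMap]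
      rw [← insert_endpoints_openSegment] at hx'
      rcases hx' with h | h | h
      · exact hxf.2 (h ▸ hv)
      · exact hne h
      · exact hxf.2 (hK.openSegment_interior_closure_subset_interior hv (hfr i).1 h)
    · rintro x rfl
      exact ⟨right_mem_segment _ _ _, hfr i⟩
  · intro i j hij
    apply Set.Subset.antisymm
    · rintro x ⟨hx, hy⟩
      rw [segment_eq_image'] at hx hy
      obtain ⟨s, hs, rfl⟩ := hx
      obtain ⟨t, ht, h⟩ := hy
      have := key i j hij s t hs.1 ht.1 (add_left_cancel h.symm)
      subst this
      simp
    · rintro x rfl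
      exact ⟨left_mem_segment _ _ _, left_mem_segment _ _ _⟩
  · have hadd : ∀ i : Fin k, (⟨0, hk0⟩ : Fin k) + i = i := by
      intro i
      apply Fin.ext
      rw [Fin.val_add]
      simp [Nat.mod_eq_of_lt i.2]
    intro j l hjl
    simp only [hadd]
    by_cases hj : j = ⟨0, hk0⟩
    · subst hj
      have e : ccwAngleFrom (P ⟨0, hk0⟩ - v) (P ⟨0, hk0⟩ - v) = 0 := by
        simp [ccwAngleFrom]
      rw [e]
      refine lt_of_le_of_ne (aux_range _ _).1 (fun h => ?_)
      obtain ⟨r, hr, h1, h2⟩ := aux_polar (P ⟨0, hk0⟩ - v)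
      obtain ⟨s, hs, h3, h4⟩ := aux_polar (P l - v)
      obtain ⟨n, hn⟩ := aux_angle (P ⟨0, hk0⟩ - v) (P l - v)
      rw [← h, add_zero] at hn
      rw [hn, Real.cos_sub_int_mul_two_pi] at h3
      rw [hn, Real.sin_sub_int_mul_two_pi] at h4
      have hs0 := key _ _ hjl.ne s r hs hr (by
        ext
        · rw [Prod.smul_fst, Prod.smul_fst, h1, h3]; simp only [smul_eq_mul]; ring
        · rw [Prod.smul_snd, Prod.smul_snd, h2, h4]; simp only [smul_eq_mul]; ring)
      have hz : P l - v = 0 := by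
        ext
        · rw [h3, hs0]; simp
        · rw [h4, hs0]; simp
      have := hf0 l
      rw [hz, map_zero] at this
      exact lt_irrefl _ this
    · have h0j : (⟨0, hk0⟩ : Fin k) < j := by
        rw [Fin.lt_def]
        have : j.val ≠ 0 := fun h => hj (Fin.ext h)
        simp only
        omega
      generalize (⟨0, hk0⟩ : Fin k) = i at h0j
      have hd := hccw i j l h0j hjl
      have hd' : det2 (P j - P i) (P l - P i) = det2 (P i - v) (P j - v)
          + det2 (P j - v) (P l - v) + det2 (P l - v) (P i - v) := by
        simp [det2]; ring
      rw [hd'] at hd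
      apply aux_lt
      · exact aux_two (f i) _ _ _ (hf0 i) (hf i _ (hfr j)) (hf i _ (hfr l)) hd
      · exact aux_two (f j) _ _ _ (hf0 j) (hf j _ (hfr l)) (hf j _ (hfr i)) (by linarith)
      · exact aux_two (f l) _ _ _ (hf0 l) (hf l _ (hfr i)) (hf l _ (hfr j)) (by linarith)
end

section
/- Let T be a finite rooted tree with depth function dep (depth of the root is 0) and parent function par, and let x : V(T) → ℤ satisfy: (i) any two distinct vertices of equal depth have distinct x-values; (ii) for any two non-root vertices u, w with dep(u) = dep(w) and x(u) < x(w), their parents satisfy x(par(u)) ≤ x(par(w)). Place each vertex v at the point (x(v), −dep(v)) ∈ ℤ² and represent each tree edge {par(v), v} by the closed straight segment between the points of its endpoints. Then any two distinct edge segments intersect at most in a common endpoint; in particular the drawing is planar. -/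
/-- The point `(x v, -dep v)` of `ℝ²` at which vertex `v` is placed. -/
def levelPt {N : ℕ} (x : Fin N → ℤ) (dep : Fin N → ℕ) (v : Fin N) : ℝ × ℝ :=
  ((x v : ℝ), -(dep v : ℝ))

/-!
STATEMENT 7.  A finite rooted tree is encoded by its vertex set `Fin N`, a root `r`,
a parent function `par` and a depth function `dep` with `dep r = 0` and
`dep v = dep (par v) + 1` for every non-root vertex `v` (this forces every vertex to
reach the unique root `r` by iterating `par`).  Suppose `x : Fin N → ℤ` satisfies:
(i) distinct vertices of equal depth have distinct `x`-values; (ii) for non-root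
vertices `u, w` of equal depth, `x u < x w` implies `x (par u) ≤ x (par w)`.
Placing each vertex `v` at `(x v, -dep v)` and drawing each tree edge
`{par v, v}` (for `v ≠ r`) as a closed straight segment, any two distinct edge
segments intersect at most in a common endpoint; in particular the drawing is
planar.
-/
theorem level_drawing_planar
    (N : ℕ) (r : Fin N) (par : Fin N → Fin N) (dep : Fin N → ℕ)
    (hroot : dep r = 0) (hdep : ∀ v, v ≠ r → dep v = dep (par v) + 1)
    (x : Fin N → ℤ)
    (hx : ∀ u w, u ≠ w → dep u = dep w → x u ≠ x w)
    (hpar : ∀ u w, u ≠ r → w ≠ r → dep u = dep w → x u < x w →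
      x (par u) ≤ x (par w)) :
    ∀ u w, u ≠ r → w ≠ r → u ≠ w →
      segment ℝ (levelPt x dep (par u)) (levelPt x dep u) ∩
        segment ℝ (levelPt x dep (par w)) (levelPt x dep w) ⊆
      ({levelPt x dep (par u), levelPt x dep u} : Set (ℝ × ℝ)) ∩
        {levelPt x dep (par w), levelPt x dep w} := by
  rintro u w hu hw huw p ⟨hp1, hp2⟩
  obtain ⟨a, s, ha, hs, has, rfl⟩ := hp1
  obtain ⟨b, t, hb, ht, hbt, hq⟩ := hp2
  have hae : a = 1 - s := by linarith
  have hbe : b = 1 - t := by linarith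
  subst hae
  subst hbe
  have h1 := congrArg Prod.fst hq
  have h2 := congrArg Prod.snd hq
  simp only [levelPt, Prod.fst_add, Prod.snd_add, Prod.smul_fst, Prod.smul_snd,
    smul_eq_mul] at h1 h2
  have du : (dep u : ℝ) = dep (par u) + 1 := by exact_mod_cast hdep u hu
  have dw : (dep w : ℝ) = dep (par w) + 1 := by exact_mod_cast hdep w hw
  rw [du, dw] at h2
  have h3 : (dep (par w) : ℝ) + t = dep (par u) + s := by linarith
  have key : (s = 0 ∨ s = 1) ∧ (t = 0 ∨ t = 1) := by
    rcases lt_trichotomy (dep (par u)) (dep (par w)) with h | h | h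
    · have h' : (dep (par u) : ℝ) + 1 ≤ dep (par w) := by exact_mod_cast h
      exact ⟨Or.inr (by linarith), Or.inl (by linarith)⟩
    · have hd : dep u = dep w := by rw [hdep u hu, hdep w hw, h]
      rw [h] at h3
      have hst : t = s := by linarith
      subst hst
      have ht0 : t = 0 := by
        by_contra hne
        have htpos : 0 < t := lt_of_le_of_ne ht (Ne.symm hne)
        rcases lt_or_gt_of_ne (hx u w huw hd) with hlt | hlt
        · have e1 : (x (par u) : ℝ) ≤ x (par w) := by
            exact_mod_cast hpar u w hu hw hd hlt
          have e2 : (x u : ℝ) < x w := by exact_mod_cast hlt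
          linarith [mul_le_mul_of_nonneg_left e1 ha, mul_lt_mul_of_pos_left e2 htpos]
        · have e1 : (x (par w) : ℝ) ≤ x (par u) := by
            exact_mod_cast hpar w u hw hu hd.symm hlt
          have e2 : (x w : ℝ) < x u := by exact_mod_cast hlt
          linarith [mul_le_mul_of_nonneg_left e1 ha, mul_lt_mul_of_pos_left e2 htpos]
      exact ⟨Or.inl ht0, Or.inl ht0⟩
    · have h' : (dep (par w) : ℝ) + 1 ≤ dep (par u) := by exact_mod_cast h
      exact ⟨Or.inl (by linarith), Or.inr (by linarith)⟩
  refine ⟨?_, ?_⟩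
  · rcases key.1 with h | h
    · left; simp [h]
    · right; simp [h]
  · rw [← hq]
    rcases key.2 with h | h
    · left; simp [h]
    · right; simp [h]
end
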